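/- Fix n ≥ 1 and N ∈ ℕ. There exists a real number s₀ (depending only on n and N) such that for every smooth function φ : GL_n(F) → ℂ of moderate growth of exponent N, every c ∈ C_c^∞(GL_n(F)), every unitary character χ : Fˣ → ℂˣ, and every s ∈ ℂ with Re(s) < s₀, the Mellin transform ∫_{Fˣ} k_{c,φ}(x)·χ(x)^{-1}·|x|_F^{-s} d^×x converges absolutely, where k_{c,φ}(x) = ∫_{SL_n(F)} (Φ_GJ * c^∨)(t₁(x)·h)·φ(t₁(x)·h) d₁h and d^×x = dx/|x|_F is a Haar measure on Fˣ. -/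

import Mathlib

open MeasureTheory Matrix

/-- The normalized absolute value `|x|_F = ‖x‖^[F:ℝ]` on an Archimedean local field `F`
(the usual absolute value on `ℝ`, the square of the modulus on `ℂ`). -/
noncomputable def absNorm (F : Type*) [RCLike F] (x : F) : ℝ :=
  ‖x‖ ^ Module.finrank ℝ F

/-- The standard nontrivial unitary additive character
`ψ(x) = e^{2πi·Tr_{F/ℝ}(x)}` of `F`, where `Tr_{F/ℝ}(x) = [F:ℝ]·Re(x)`. -/
noncomputable def psiArch (F : Type*) [RCLike F] (x : F) : ℂ :=
  Complex.exp (2 * Real.pi * Complex.I * (Module.finrank ℝ F : ℂ) * ((RCLike.re x : ℝ) : ℂ))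

/-- The Haar measure `dg = d⁺g / |det g|_F^n` on `GL_n(F)`, obtained from the Lebesgue
(additive Haar) measure `μp` on `M_n(F)` by the density `|det g|_F^{-n}`. -/
noncomputable def muGLArch (F : Type*) [RCLike F] (n : ℕ)
    [MeasurableSpace (Matrix (Fin n) (Fin n) F)]
    (μp : Measure (Matrix (Fin n) (Fin n) F)) : Measure (Matrix (Fin n) (Fin n) F) :=
  μp.withDensity fun g => ENNReal.ofReal ((absNorm F g.det ^ n)⁻¹)

/-- The Godement–Jacquet kernel `Φ_GJ(g) = ψ(tr g)·|det g|_F^{n/2}`. -/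
noncomputable def PhiGJArch (F : Type*) [RCLike F] (n : ℕ) :
    Matrix (Fin n) (Fin n) F → ℂ :=
  fun g => psiArch F g.trace * ((absNorm F g.det ^ ((n : ℝ) / 2) : ℝ) : ℂ)

/-- The convolution `(Φ_GJ * c^∨)(g) = ∫_{GL_n(F)} Φ_GJ(h)·c(g⁻¹h) dh`, the integral being
taken with respect to the Haar measure of `GL_n(F)`. -/
noncomputable def convGJArch (F : Type*) [RCLike F] (n : ℕ)
    [MeasurableSpace (Matrix (Fin n) (Fin n) F)]
    (μp : Measure (Matrix (Fin n) (Fin n) F))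
    (c : Matrix (Fin n) (Fin n) F → ℂ) (g : Matrix (Fin n) (Fin n) F) : ℂ :=
  ∫ h, PhiGJArch F n h * c (g⁻¹ * h) ∂(muGLArch F n μp)

/-- `t₁(x) = diag(x, 1, …, 1)`, a section of the determinant map. -/
noncomputable def t1Arch (F : Type*) [RCLike F] (n : ℕ) (x : F) :
    Matrix (Fin n) (Fin n) F :=
  Matrix.diagonal fun i => if (i : ℕ) = 0 then x else 1

section Aux

variable {F : Type*} [RCLike F]

variable {n : ℕ}

/-- The largest absolute value of an entry of a matrix. -/
noncomputable def entryNorm (g : Matrix (Fin n) (Fin n) F) : ℝ :=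
  ‖(fun i j => g i j : Fin n → Fin n → F)‖

theorem entryNorm_nonneg (g : Matrix (Fin n) (Fin n) F) : 0 ≤ entryNorm g := norm_nonneg _

theorem norm_entry_le (g : Matrix (Fin n) (Fin n) F) (i j : Fin n) : ‖g i j‖ ≤ entryNorm g :=
  (norm_le_pi_norm (g i) j).trans (norm_le_pi_norm (fun i j => g i j : Fin n → Fin n → F) i)

theorem entryNorm_le {g : Matrix (Fin n) (Fin n) F} {r : ℝ} (hr : 0 ≤ r)
    (h : ∀ i j, ‖g i j‖ ≤ r) : entryNorm g ≤ r :=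
  (pi_norm_le_iff_of_nonneg hr).2 fun i => (pi_norm_le_iff_of_nonneg hr).2 (h i)

theorem continuous_entryNorm :
    Continuous (entryNorm : Matrix (Fin n) (Fin n) F → ℝ) := by
  unfold entryNorm
  refine Continuous.norm ?_
  exact continuous_pi fun i => continuous_pi fun j => continuous_id.matrix_elem i j

theorem entryNorm_mul_le (g h : Matrix (Fin n) (Fin n) F) :
    entryNorm (g * h) ≤ n * (entryNorm g * entryNorm h) := by
  have hg := entryNorm_nonneg g
  have hh := entryNorm_nonneg h
  refine entryNorm_le (by positivity) fun i j => ?_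
  rw [mul_apply]
  refine (norm_sum_le _ _).trans ?_
  refine (Finset.sum_le_card_nsmul _ _ (entryNorm g * entryNorm h) fun k _ => ?_).trans ?_
  · rw [norm_mul]
    exact mul_le_mul (norm_entry_le g i k) (norm_entry_le h k j) (norm_nonneg _) hg
  · simp

theorem norm_det_le_of_entry_le {g : Matrix (Fin n) (Fin n) F} {r : ℝ}
    (h : ∀ i j, ‖g i j‖ ≤ r) : ‖g.det‖ ≤ n.factorial * r ^ n := by
  have := Matrix.det_le (abv := NormedField.toAbsoluteValue F) h
  rw [Fintype.card_fin, nsmul_eq_mul] at this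
  exact this

theorem norm_det_le (g : Matrix (Fin n) (Fin n) F) :
    ‖g.det‖ ≤ n.factorial * (1 + entryNorm g) ^ n :=
  norm_det_le_of_entry_le fun i j => (norm_entry_le g i j).trans (by linarith)

theorem entryNorm_adjugate_le (g : Matrix (Fin n) (Fin n) F) :
    entryNorm g.adjugate ≤ n.factorial * (1 + entryNorm g) ^ n := by
  have hg := entryNorm_nonneg g
  refine entryNorm_le (by positivity) fun i j => ?_
  rw [adjugate_apply]
  refine norm_det_le_of_entry_le fun k l => ?_
  rw [updateRow_apply]
  split_ifs with h
  · rw [Pi.single_apply]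
    split_ifs
    · simpa using hg
    · simp; positivity
  · exact (norm_entry_le g k l).trans (by linarith)

theorem re_trace_conjTranspose_mul_self_le (g : Matrix (Fin n) (Fin n) F) :
    RCLike.re ((gᴴ * g).trace) ≤ n ^ 2 * entryNorm g ^ 2 := by
  have h : RCLike.re ((gᴴ * g).trace) = ∑ i, ∑ j, ‖g j i‖ ^ 2 := by
    simp only [trace, diag_apply, mul_apply, conjTranspose_apply, map_sum]
    refine Finset.sum_congr rfl fun i _ => Finset.sum_congr rfl fun j _ => ?_
    rw [RCLike.star_def, RCLike.conj_mul, ← RCLike.ofReal_pow, RCLike.ofReal_re]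
  rw [h]
  calc ∑ i, ∑ j, ‖g j i‖ ^ 2 ≤ ∑ _i : Fin n, ∑ _j : Fin n, entryNorm g ^ 2 := by
        gcongr with i _ j _
        exact norm_entry_le g j i
    _ = _ := by simp; ring

theorem re_trace_nonneg (g : Matrix (Fin n) (Fin n) F) :
    0 ≤ RCLike.re ((gᴴ * g).trace) := by
  simp only [trace, diag_apply, mul_apply, conjTranspose_apply, map_sum]
  refine Finset.sum_nonneg fun i _ => Finset.sum_nonneg fun j _ => ?_
  rw [RCLike.star_def, RCLike.conj_mul, ← RCLike.ofReal_pow, RCLike.ofReal_re]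
  positivity

/-- The moderate growth gauge on `GL_n(F)` is polynomial in the entries and `|det g|⁻¹`. -/
theorem exists_gauge_le (n N : ℕ) : ∃ A : ℝ, 0 < A ∧ ∀ g : Matrix (Fin n) (Fin n) F, g.det ≠ 0 →
    (1 + RCLike.re ((gᴴ * g).trace) + RCLike.re (((g⁻¹)ᴴ * g⁻¹).trace)) ^ N ≤
      A * (1 + entryNorm g) ^ (4 * n * N + 2 * N) * (‖g.det‖ ^ (2 * N))⁻¹ := by
  set f : ℝ := (n.factorial : ℝ) with hf
  have hf1 : 1 ≤ f := by rw [hf]; exact_mod_cast Nat.one_le_iff_ne_zero.2 n.factorial_ne_zero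
  refine ⟨((1 + n ^ 2 + n ^ 2) * f ^ 2) ^ N, by positivity, fun g hg => ?_⟩
  have hδ : 0 < ‖g.det‖ := norm_pos_iff.2 hg
  set δ := ‖g.det‖ with hδdef
  set r := 1 + entryNorm g with hr
  have hr1 : 1 ≤ r := by have := entryNorm_nonneg g; linarith
  have h1 : entryNorm g⁻¹ ≤ f * r ^ n / δ := by
    refine entryNorm_le (by positivity) fun i j => ?_
    rw [inv_def, Matrix.smul_apply, smul_eq_mul, norm_mul, Ring.inverse_eq_inv', norm_inv, ← hδdef,
      div_eq_inv_mul]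
    gcongr
    exact (norm_entry_le _ _ _).trans (entryNorm_adjugate_le g)
  have h2 : δ ≤ f * r ^ n := norm_det_le g
  have h3 : 1 + RCLike.re ((gᴴ * g).trace) + RCLike.re (((g⁻¹)ᴴ * g⁻¹).trace) ≤
      1 + n ^ 2 * r ^ 2 + n ^ 2 * (f * r ^ n / δ) ^ 2 := by
    have e1 := re_trace_conjTranspose_mul_self_le g
    have e2 := re_trace_conjTranspose_mul_self_le g⁻¹
    have e3 : entryNorm g ^ 2 ≤ r ^ 2 := by
      have := entryNorm_nonneg g
      gcongr; linarith
    have e4 : entryNorm g⁻¹ ^ 2 ≤ (f * r ^ n / δ) ^ 2 := by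
      have := entryNorm_nonneg g⁻¹
      gcongr
    have e5 : (n : ℝ) ^ 2 * entryNorm g ^ 2 ≤ n ^ 2 * r ^ 2 := by gcongr
    have e6 : (n : ℝ) ^ 2 * entryNorm g⁻¹ ^ 2 ≤ n ^ 2 * (f * r ^ n / δ) ^ 2 := by gcongr
    linarith
  have h4 : 1 + n ^ 2 * r ^ 2 + n ^ 2 * (f * r ^ n / δ) ^ 2 ≤
      (1 + n ^ 2 + n ^ 2) * f ^ 2 * (r ^ (4 * n + 2) / δ ^ 2) := by
    have k1 : 1 ≤ f * r ^ n / δ := (one_le_div hδ).2 h2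
    have k2 : 1 ≤ r ^ 2 := one_le_pow₀ hr1
    have k3 : 1 ≤ (f * r ^ n / δ) ^ 2 := one_le_pow₀ k1
    have k4 : r ^ 2 * (f * r ^ n / δ) ^ 2 ≤ f ^ 2 * (r ^ (4 * n + 2) / δ ^ 2) := by
      have : r ^ 2 * (f * r ^ n / δ) ^ 2 = f ^ 2 * (r ^ (2 * n + 2) / δ ^ 2) := by
        field_simp; ring
      rw [this]
      have hp : r ^ (2 * n + 2) ≤ r ^ (4 * n + 2) := pow_le_pow_right₀ hr1 (by omega)
      gcongr
    have k5 : 1 ≤ r ^ 2 * (f * r ^ n / δ) ^ 2 := one_le_mul_of_one_le_of_one_le k2 k3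
    have k6 : r ^ 2 ≤ r ^ 2 * (f * r ^ n / δ) ^ 2 := le_mul_of_one_le_right (by positivity) k3
    have k7 : (f * r ^ n / δ) ^ 2 ≤ r ^ 2 * (f * r ^ n / δ) ^ 2 :=
      le_mul_of_one_le_left (by positivity) k2
    have n0 : (0:ℝ) ≤ (n:ℝ) ^ 2 := by positivity
    calc _ ≤ (1 + n ^ 2 + n ^ 2) * (r ^ 2 * (f * r ^ n / δ) ^ 2) := by nlinarith
      _ ≤ (1 + n ^ 2 + n ^ 2) * (f ^ 2 * (r ^ (4 * n + 2) / δ ^ 2)) := by gcongr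
      _ = _ := by ring
  calc _ ≤ ((1 + n ^ 2 + n ^ 2) * f ^ 2 * (r ^ (4 * n + 2) / δ ^ 2)) ^ N := by
        have := re_trace_nonneg g
        have := re_trace_nonneg g⁻¹
        exact pow_le_pow_left₀ (by positivity) (h3.trans h4) N
    _ = _ := by
        rw [mul_pow _ _ N, div_pow, ← pow_mul, ← pow_mul, div_eq_mul_inv, ← mul_assoc]
        congr 3
        ring

theorem det_t1Arch (hn : 1 ≤ n) (x : F) : (t1Arch F n x).det = x := by
  obtain ⟨m, rfl⟩ : ∃ m, n = m + 1 := ⟨n - 1, by omega⟩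
  simp [t1Arch, det_diagonal]

theorem t1Arch_mul (x y : F) : t1Arch F n (x * y) = t1Arch F n x * t1Arch F n y := by
  simp only [t1Arch, diagonal_mul_diagonal]
  congr 1; ext i; split_ifs <;> simp

theorem t1Arch_one : t1Arch F n 1 = 1 := by
  simp [t1Arch]

theorem continuous_t1Arch : Continuous (t1Arch F n) := by
  unfold t1Arch
  refine Continuous.matrix_diagonal (continuous_pi fun i => ?_)
  split_ifs <;> fun_prop

theorem entryNorm_t1Arch_le (x : F) : entryNorm (t1Arch F n x) ≤ 1 + ‖x‖ := by
  refine entryNorm_le (by positivity) fun i j => ?_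
  unfold t1Arch
  rw [diagonal_apply]
  split_ifs
  · simp
  · simp
  · simp; positivity

theorem isCompact_entryNorm_le (r : ℝ) :
    IsCompact {g : Matrix (Fin n) (Fin n) F | entryNorm g ≤ r} := by
  have h : IsCompact {g : Fin n → Fin n → F | ‖g‖ ≤ r} := by
    simpa [Metric.closedBall, dist_zero_right] using
      isCompact_closedBall (0 : Fin n → Fin n → F) r
  exact h

theorem continuous_fourierIntegral_and_decay {V : Type*} [NormedAddCommGroup V] [NormedSpace ℝ V]
    [FiniteDimensional ℝ V] [MeasurableSpace V] [BorelSpace V]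
    {W : Type*} [NormedAddCommGroup W] [NormedSpace ℝ W]
    (μ : Measure V) [μ.IsAddHaarMeasure] (L : V →L[ℝ] W →L[ℝ] ℝ)
    (hL : ∀ w, ∃ v, ‖v‖ ≤ 1 ∧ ‖w‖ ≤ |L v w|)
    {f : V → ℂ} (hf : ContDiff ℝ (⊤ : ℕ∞) f) (hfc : HasCompactSupport f) :
    Continuous (fun w => ∫ v, (Real.fourierChar (-L v w) : ℂ) * f v ∂μ) ∧
      ∀ M : ℕ, ∃ C : ℝ, ∀ w, ‖∫ v, (Real.fourierChar (-L v w) : ℂ) * f v ∂μ‖ *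
        (1 + ‖w‖) ^ M ≤ C := by
  have heq : (fun w => ∫ v, (Real.fourierChar (-L v w) : ℂ) * f v ∂μ) =
      VectorFourier.fourierIntegral Real.fourierChar μ L.toLinearMap₁₂ f := rfl
  have hint : ∀ k m : ℕ, Integrable (fun v => ‖v‖ ^ k * ‖iteratedFDeriv ℝ m f v‖) μ := by
    intro k m
    refine Continuous.integrable_of_hasCompactSupport ?_ ?_
    · exact (continuous_norm.pow k).mul
        (hf.continuous_iteratedFDeriv (by exact_mod_cast le_top)).norm
    · exact (hfc.iteratedFDeriv (𝕜 := ℝ) m).norm.mul_left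
  refine ⟨?_, fun M => ?_⟩
  · rw [heq]
    exact VectorFourier.fourierIntegral_continuous Real.continuous_fourierChar L.continuous₂
      (hf.continuous.integrable_of_hasCompactSupport hfc)
  · have hb : ∀ m : ℕ, ∃ C : ℝ, ∀ w,
        ‖w‖ ^ m * ‖∫ v, (Real.fourierChar (-L v w) : ℂ) * f v ∂μ‖ ≤ C := by
      intro m
      refine ⟨2 ^ m * ∑ p ∈ Finset.range 1 ×ˢ Finset.range (m + 1),
          ∫ v, ‖v‖ ^ p.1 * ‖iteratedFDeriv ℝ p.2 f v‖ ∂μ, fun w => ?_⟩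
      obtain ⟨v, hv, hvw⟩ := hL w
      have h := VectorFourier.pow_mul_norm_iteratedFDeriv_fourierIntegral_le L (K := ⊤) (N := ⊤)
        (μ := μ) hf (fun k m _ _ => hint k m) (k := 0) (n := m) le_top le_top v w
      rw [norm_iteratedFDeriv_zero, ← heq] at h
      calc _ ≤ |L v w| ^ m * ‖∫ v, (Real.fourierChar (-L v w) : ℂ) * f v ∂μ‖ := by gcongr
        _ ≤ _ := h
        _ ≤ 1 * 1 * 2 ^ m * ∑ p ∈ Finset.range 1 ×ˢ Finset.range (m + 1),
            ∫ v, ‖v‖ ^ p.1 * ‖iteratedFDeriv ℝ p.2 f v‖ ∂μ := by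
          have hS : 0 ≤ ∑ p ∈ Finset.range 1 ×ˢ Finset.range (m + 1),
              ∫ v, ‖v‖ ^ p.1 * ‖iteratedFDeriv ℝ p.2 f v‖ ∂μ :=
            Finset.sum_nonneg fun p _ => integral_nonneg fun v => by positivity
          simp only [Nat.cast_zero, mul_zero, zero_add, pow_zero]
          gcongr
          exact pow_le_one₀ (norm_nonneg v) hv
        _ = _ := by ring
    obtain ⟨C0, hC0⟩ := hb 0
    obtain ⟨C1, hC1⟩ := hb M
    refine ⟨2 ^ (M - 1) * (C0 + C1), fun w => ?_⟩
    have h0 := hC0 w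
    have h1 := hC1 w
    rw [pow_zero, one_mul] at h0
    calc _ ≤ ‖∫ v, (Real.fourierChar (-L v w) : ℂ) * f v ∂μ‖ *
          (2 ^ (M - 1) * (1 ^ M + ‖w‖ ^ M)) := by
          gcongr
          exact add_pow_le zero_le_one (norm_nonneg w) M
      _ = 2 ^ (M - 1) * (‖∫ v, (Real.fourierChar (-L v w) : ℂ) * f v ∂μ‖ +
          ‖w‖ ^ M * ‖∫ v, (Real.fourierChar (-L v w) : ℂ) * f v ∂μ‖) := by
          rw [one_pow]; ring
      _ ≤ _ := by gcongr

/-- The bilinear form `(v, w) ↦ -Tr_{F/ℝ}(tr (w v))` on `M_n(F)`. -/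
noncomputable def negTraceForm (F : Type*) [RCLike F] (n : ℕ) :
    (Fin n → Fin n → F) →L[ℝ] (Fin n → Fin n → F) →L[ℝ] ℝ :=
  LinearMap.toContinuousLinearMap (LinearMap.toContinuousLinearMap.toLinearMap ∘ₗ
    LinearMap.mk₂ ℝ (fun v w : Fin n → Fin n → F =>
      -((Module.finrank ℝ F : ℝ) * RCLike.re (Matrix.of w * Matrix.of v).trace))
      (fun v₁ v₂ w => by rw [← of_add_of, Matrix.mul_add, trace_add, map_add]; ring)
      (fun a v w => by
        rw [← smul_of, Matrix.mul_smul, trace_smul, RCLike.smul_re, smul_eq_mul]; ring)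
      (fun v w₁ w₂ => by rw [← of_add_of, Matrix.add_mul, trace_add, map_add]; ring)
      (fun a v w => by
        rw [← smul_of, Matrix.smul_mul, trace_smul, RCLike.smul_re, smul_eq_mul]; ring))

theorem negTraceForm_apply (v w : Fin n → Fin n → F) : negTraceForm F n v w =
    -((Module.finrank ℝ F : ℝ) * RCLike.re (Matrix.of w * Matrix.of v).trace) := rfl

theorem fourierChar_neg_negTraceForm (v w : Fin n → Fin n → F) :
    (Real.fourierChar (-negTraceForm F n v w) : ℂ) =
      psiArch F (Matrix.of w * Matrix.of v).trace := by
  rw [negTraceForm_apply, neg_neg, Real.fourierChar_apply, psiArch]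
  congr 1
  push_cast
  ring

theorem exists_norm_le_negTraceForm (w : Fin n → Fin n → F) :
    ∃ v, ‖v‖ ≤ 1 ∧ ‖w‖ ≤ |negTraceForm F n v w| := by
  rcases eq_or_ne w 0 with rfl | hw
  · exact ⟨0, by simp⟩
  obtain ⟨i, j, hij⟩ : ∃ i j, ‖w‖ ≤ ‖w i j‖ := by
    by_contra! h
    refine lt_irrefl ‖w‖ ?_
    refine (pi_norm_lt_iff (norm_pos_iff.2 hw)).2 fun i => ?_
    exact (pi_norm_lt_iff (norm_pos_iff.2 hw)).2 fun j => h i j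
  have hw0 : 0 < ‖w i j‖ := (norm_pos_iff.2 hw).trans_le hij
  obtain ⟨u, hu⟩ : ∃ u : F, u = (starRingEnd F) (w i j) * ((‖w i j‖⁻¹ : ℝ) : F) := ⟨_, rfl⟩
  have hu1 : ‖u‖ = 1 := by
    rw [hu, norm_mul, RCLike.norm_conj, RCLike.norm_ofReal, abs_of_pos (inv_pos.2 hw0),
      mul_inv_cancel₀ hw0.ne']
  have hwu : w i j * u = ((‖w i j‖ : ℝ) : F) := by
    rw [hu, ← mul_assoc, RCLike.mul_conj, ← RCLike.ofReal_pow, ← RCLike.ofReal_mul]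
    congr 1
    field_simp
  obtain ⟨v, hv⟩ : ∃ v : Fin n → Fin n → F, Matrix.of v = Matrix.single j i u := ⟨_, rfl⟩
  refine ⟨v, ?_, ?_⟩
  · refine (pi_norm_le_iff_of_nonneg zero_le_one).2 fun a =>
      (pi_norm_le_iff_of_nonneg zero_le_one).2 fun b => ?_
    rw [← Matrix.of_apply v, hv, Matrix.single_apply]
    split_ifs
    · exact hu1.le
    · simp
  · have htr : (Matrix.of w * Matrix.of v).trace = w i j * u := by
      rw [hv, Matrix.trace_mul_comm, Matrix.trace_single_mul, mul_comm, smul_eq_mul, of_apply]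
    rw [negTraceForm_apply, htr, hwu, RCLike.ofReal_re, abs_neg, abs_of_nonneg (by positivity)]
    refine hij.trans (le_mul_of_one_le_left hw0.le ?_)
    exact_mod_cast Module.finrank_pos (R := ℝ) (M := F)

theorem abs_algebraNorm_eq_absNorm (x : F) : |Algebra.norm ℝ x| = absNorm F x := by
  have h1 : Algebra.norm ℝ (starRingEnd F x) = Algebra.norm ℝ x := by
    have := Algebra.norm_eq_of_algEquiv (RCLike.conjAe (K := F)) x
    simpa using this
  have h2 : Algebra.norm ℝ x ^ 2 = absNorm F x ^ 2 := by
    calc Algebra.norm ℝ x ^ 2 = Algebra.norm ℝ (x * starRingEnd F x) := by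
          rw [map_mul, h1, sq]
      _ = Algebra.norm ℝ (algebraMap ℝ F (‖x‖ ^ 2)) := by
          rw [RCLike.mul_conj]; simp
      _ = absNorm F x ^ 2 := by
          rw [Algebra.norm_algebraMap, absNorm]; ring
  have h3 : 0 ≤ absNorm F x := by unfold absNorm; positivity
  rw [← abs_of_nonneg h3]
  exact (sq_eq_sq_iff_abs_eq_abs _ _).1 h2

theorem det_mulLeft_matrix {R : Type*} [CommRing R] (g : Matrix (Fin n) (Fin n) R) :
    LinearMap.det (LinearMap.mulLeft R g) = g.det ^ n := by
  let e : Matrix (Fin n) (Fin n) R ≃ₗ[R] (Fin n → Fin n → R) :=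
    (Matrix.transposeLinearEquiv (Fin n) (Fin n) R R).trans (Matrix.ofLinearEquiv R).symm
  have h : (e : Matrix (Fin n) (Fin n) R →ₗ[R] (Fin n → Fin n → R)) ∘ₗ LinearMap.mulLeft R g ∘ₗ
      (e.symm : (Fin n → Fin n → R) →ₗ[R] Matrix (Fin n) (Fin n) R) =
      LinearMap.pi fun j => (Matrix.toLin' g) ∘ₗ LinearMap.proj j := by
    refine LinearMap.ext fun y => ?_
    ext i j
    rfl
  rw [← LinearMap.det_conj _ e, h, LinearMap.det_pi]
  simp

theorem abs_det_mulLeft (g : Matrix (Fin n) (Fin n) F) :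
    |LinearMap.det ((LinearMap.mulLeft F g).restrictScalars ℝ)| = absNorm F g.det ^ n := by
  rw [LinearMap.det_restrictScalars, det_mulLeft_matrix, abs_algebraNorm_eq_absNorm]
  simp only [absNorm, norm_pow]
  ring

theorem absNorm_mul (x y : F) : absNorm F (x * y) = absNorm F x * absNorm F y := by
  simp [absNorm, mul_pow]

theorem absNorm_nonneg (x : F) : 0 ≤ absNorm F x := by unfold absNorm; positivity

theorem absNorm_pos {x : F} (hx : x ≠ 0) : 0 < absNorm F x := by
  unfold absNorm; have := norm_pos_iff.2 hx; positivity

theorem absNorm_eq_zero_iff {x : F} : absNorm F x = 0 ↔ x = 0 := by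
  constructor
  · intro h; by_contra hx; exact (absNorm_pos hx).ne' h
  · rintro rfl; simp [absNorm, Module.finrank_pos.ne']

theorem continuous_absNorm : Continuous (absNorm F) := by unfold absNorm; fun_prop

theorem map_withDensity_of_linearMap {E : Type*} [NormedAddCommGroup E] [NormedSpace ℝ E]
    [FiniteDimensional ℝ E] {mE : MeasurableSpace E} (bE : BorelSpace E) {μ : Measure E}
    (hμ : μ.IsAddHaarMeasure) {f : E →ₗ[ℝ] E} (hf : LinearMap.det f ≠ 0)
    {w : E → ENNReal} (hw : Measurable w)
    (hfw : ∀ y, w y = ENNReal.ofReal |LinearMap.det f| * w (f y)) :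
    Measure.map f (μ.withDensity w) = μ.withDensity w := by
  have hmeas : Measurable f := f.continuous_of_finiteDimensional.measurable
  have hpos : 0 < |LinearMap.det f| := abs_pos.2 hf
  ext s hs
  rw [Measure.map_apply hmeas hs, withDensity_apply _ (hmeas hs), withDensity_apply _ hs]
  calc ∫⁻ y in f ⁻¹' s, w y ∂μ
      = ENNReal.ofReal |LinearMap.det f| * ∫⁻ y in f ⁻¹' s, w (f y) ∂μ := by
        rw [← lintegral_const_mul _ (show Measurable fun y => w (f y) from hw.comp hmeas)]
        exact lintegral_congr hfw
    _ = ENNReal.ofReal |LinearMap.det f| * ∫⁻ y in s, w y ∂(Measure.map f μ) := by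
        rw [setLIntegral_map hs hw hmeas]
    _ = _ := by
        rw [Measure.map_linearMap_addHaar_eq_smul_addHaar μ hf, Measure.restrict_smul,
          lintegral_smul_measure, smul_eq_mul, ← mul_assoc, abs_inv,
          ← ENNReal.ofReal_mul hpos.le, mul_inv_cancel₀ hpos.ne', ENNReal.ofReal_one, one_mul]

theorem measurable_density_field [MeasurableSpace F] [BorelSpace F] :
    Measurable fun x : F => ENNReal.ofReal (absNorm F x)⁻¹ :=
  continuous_absNorm.measurable.inv.ennreal_ofReal

/-- Invariance of the Haar measure `dx / |x|_F` of `Fˣ`. -/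
theorem ae_ne_zero_field [MeasurableSpace F] [BorelSpace F] (μF : Measure F) :
    ∀ᵐ x ∂(μF.withDensity fun x => ENNReal.ofReal (absNorm F x)⁻¹), x ≠ 0 := by
  rw [ae_withDensity_iff measurable_density_field]
  refine Filter.Eventually.of_forall fun x hx hx0 => hx ?_
  simp [hx0, absNorm_eq_zero_iff.2 rfl]

theorem map_mul_left_field [MeasurableSpace F] [BorelSpace F] (μF : Measure F)
    [μF.IsAddHaarMeasure] {a : F} (ha : a ≠ 0) :
    Measure.map (fun x => a * x) (μF.withDensity fun x => ENNReal.ofReal (absNorm F x)⁻¹) =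
      μF.withDensity fun x => ENNReal.ofReal (absNorm F x)⁻¹ := by
  have hpos := absNorm_pos ha
  have hdet : |LinearMap.det (LinearMap.mulLeft ℝ a)| = absNorm F a := by
    rw [← abs_algebraNorm_eq_absNorm, Algebra.norm_apply]; rfl
  refine map_withDensity_of_linearMap (f := LinearMap.mulLeft ℝ a) inferInstance inferInstance
    ?_ measurable_density_field fun y => ?_
  · rw [← abs_ne_zero, hdet]; exact hpos.ne'
  · rw [hdet, LinearMap.mulLeft_apply, ← ENNReal.ofReal_mul hpos.le, absNorm_mul, mul_inv,
      mul_inv_cancel_left₀ hpos.ne']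

theorem contDiff_det : ContDiff ℝ (⊤ : ℕ∞) fun g : Fin n → Fin n → F => (Matrix.of g).det := by
  simp only [Matrix.det_apply, Matrix.of_apply]
  fun_prop

theorem contDiffAt_norm_of_ne_zero {x : F} (hx : x ≠ 0) :
    ContDiffAt ℝ (⊤ : ℕ∞) (fun y : F => ‖y‖) x := by
  have h : (fun y : F => ‖y‖) = fun y : F => √(RCLike.reCLM y * RCLike.reCLM y +
      RCLike.imCLM y * RCLike.imCLM y) := by
    ext y
    rw [RCLike.reCLM_apply, RCLike.imCLM_apply, ← RCLike.norm_sq_eq_def,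
      Real.sqrt_sq (norm_nonneg y)]
  rw [h]
  refine ContDiffAt.sqrt (by fun_prop) ?_
  rw [RCLike.reCLM_apply, RCLike.imCLM_apply, ← RCLike.norm_sq_eq_def]
  exact pow_ne_zero 2 (norm_ne_zero_iff.2 hx)

/-- The function `h ↦ c(h) |det h|_F^{n/2 - n}`, whose Fourier transform governs `Φ_GJ * c^∨`. -/
noncomputable def detTwist (F : Type*) [RCLike F] (n : ℕ) (c : Matrix (Fin n) (Fin n) F → ℂ)
    (h : Fin n → Fin n → F) : ℂ :=
  c (Matrix.of h) * ((absNorm F (Matrix.of h).det ^ ((n : ℝ) / 2) *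
    (absNorm F (Matrix.of h).det ^ n)⁻¹ : ℝ) : ℂ)

theorem hasCompactSupport_detTwist {c : Matrix (Fin n) (Fin n) F → ℂ}
    (hcs : HasCompactSupport (fun g : Fin n → Fin n → F => c (Matrix.of g))) :
    HasCompactSupport (detTwist F n c) := hcs.mul_right

theorem contDiff_detTwist {c : Matrix (Fin n) (Fin n) F → ℂ}
    (hc : ContDiff ℝ (⊤ : ℕ∞) (fun g : Fin n → Fin n → F => c (Matrix.of g)))
    (hcd : tsupport (fun g : Fin n → Fin n → F => c (Matrix.of g))
          ⊆ {g : Fin n → Fin n → F | (Matrix.of g).det ≠ 0}) :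
    ContDiff ℝ (⊤ : ℕ∞) (detTwist F n c) := by
  refine contDiff_iff_contDiffAt.2 fun g => ?_
  by_cases hg : g ∈ tsupport (detTwist F n c)
  swap
  · exact contDiffAt_const.congr_of_eventuallyEq (notMem_tsupport_iff_eventuallyEq.1 hg)
  have hdet : (Matrix.of g).det ≠ 0 := hcd (tsupport_mul_subset_left hg)
  have h1 : ContDiffAt ℝ (⊤ : ℕ∞)
      (fun h : Fin n → Fin n → F => absNorm F (Matrix.of h).det) g :=
    ((contDiffAt_norm_of_ne_zero hdet).comp g contDiff_det.contDiffAt).pow _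
  have h2 : absNorm F (Matrix.of g).det ≠ 0 := (absNorm_pos hdet).ne'
  have h3 : ContDiffAt ℝ (⊤ : ℕ∞)
      (fun h : Fin n → Fin n → F => absNorm F (Matrix.of h).det ^ ((n : ℝ) / 2) *
        (absNorm F (Matrix.of h).det ^ n)⁻¹) g :=
    (h1.rpow_const_of_ne h2).mul ((h1.pow n).inv (pow_ne_zero n h2))
  exact hc.contDiffAt.mul (Complex.ofRealCLM.contDiff.contDiffAt.comp g h3)

variable [mm : MeasurableSpace (Matrix (Fin n) (Fin n) F)]
  [bm : BorelSpace (Matrix (Fin n) (Fin n) F)]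

theorem measurable_density :
    Measurable fun g : Matrix (Fin n) (Fin n) F => ENNReal.ofReal ((absNorm F g.det ^ n)⁻¹) := by
  have : Continuous fun g : Matrix (Fin n) (Fin n) F => absNorm F g.det ^ n :=
    (continuous_absNorm.comp (continuous_id.matrix_det)).pow n
  exact this.measurable.inv.ennreal_ofReal

/-- Left invariance of the Haar measure of `GL_n(F)`. -/
theorem map_mul_left_muGLArch (μp : Measure (Matrix (Fin n) (Fin n) F))
    [hμ : μp.IsAddHaarMeasure] {g : Matrix (Fin n) (Fin n) F} (hg : g.det ≠ 0) :
    Measure.map (fun y => g * y) (muGLArch F n μp) = muGLArch F n μp := by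
  have hpos : 0 < absNorm F g.det ^ n := pow_pos (absNorm_pos hg) n
  have hdet : LinearMap.det ((LinearMap.mulLeft F g).restrictScalars ℝ) ≠ 0 := by
    rw [← abs_ne_zero, abs_det_mulLeft]; exact hpos.ne'
  refine map_withDensity_of_linearMap (E := Fin n → Fin n → F)
    (f := (LinearMap.mulLeft F g).restrictScalars ℝ) bm hμ hdet measurable_density ?_
  intro y
  change ENNReal.ofReal ((absNorm F (Matrix.of y).det ^ n)⁻¹) =
    ENNReal.ofReal |LinearMap.det ((LinearMap.mulLeft F g).restrictScalars ℝ)| *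
      ENNReal.ofReal ((absNorm F (g * Matrix.of y).det ^ n)⁻¹)
  rw [abs_det_mulLeft, ← ENNReal.ofReal_mul hpos.le, det_mul, absNorm_mul, mul_pow, mul_inv,
    mul_inv_cancel_left₀ hpos.ne']

theorem lintegral_prod_t1Arch_mul_left [MeasurableSpace F] [BorelSpace F] (hn : 1 ≤ n)
    (μ₁ : Measure (Matrix (Fin n) (Fin n) F)) [SFinite μ₁]
    (hμ₁inv : ∀ s : Matrix (Fin n) (Fin n) F, s.det = 1 →
      Measure.map (fun h => s * h) μ₁ = μ₁)
    (μF : Measure F) [μF.IsAddHaarMeasure]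
    {Q : Matrix (Fin n) (Fin n) F → ENNReal} (hQ : Measurable Q)
    {y : Matrix (Fin n) (Fin n) F} (hy : y.det ≠ 0) :
    ∫⁻ x, ∫⁻ h, Q (y * (t1Arch F n x * h)) ∂μ₁
        ∂(μF.withDensity fun x => ENNReal.ofReal (absNorm F x)⁻¹) =
      ∫⁻ x, ∫⁻ h, Q (t1Arch F n x * h) ∂μ₁
        ∂(μF.withDensity fun x => ENNReal.ofReal (absNorm F x)⁻¹) := by
  set D := μF.withDensity fun x => ENNReal.ofReal (absNorm F x)⁻¹ with hD
  set δ := y.det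
  have hmulc : ∀ a : Matrix (Fin n) (Fin n) F, Measurable fun h => a * h := fun a =>
    (continuous_const.matrix_mul continuous_id).measurable
  have hinner : ∀ x : F, x ≠ 0 → ∫⁻ h, Q (y * (t1Arch F n x * h)) ∂μ₁ =
      ∫⁻ h, Q (t1Arch F n (δ * x) * h) ∂μ₁ := by
    intro x hx
    set s := t1Arch F n (δ * x)⁻¹ * y * t1Arch F n x with hs
    have hδx : δ * x ≠ 0 := mul_ne_zero hy hx
    have hsdet : s.det = 1 := by
      rw [hs, det_mul, det_mul, det_t1Arch hn, det_t1Arch hn, mul_assoc,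
        inv_mul_cancel₀ hδx]
    have hy' : ∀ h, y * (t1Arch F n x * h) = t1Arch F n (δ * x) * (s * h) := by
      intro h
      simp only [hs, ← Matrix.mul_assoc]
      rw [← t1Arch_mul, mul_inv_cancel₀ hδx, t1Arch_one, Matrix.one_mul]
    calc _ = ∫⁻ h, Q (t1Arch F n (δ * x) * (s * h)) ∂μ₁ := by simp only [hy']
      _ = ∫⁻ h, Q (t1Arch F n (δ * x) * h) ∂(Measure.map (fun h => s * h) μ₁) := by
        rw [lintegral_map (show Measurable fun h => Q (t1Arch F n (δ * x) * h) from
          hQ.comp (hmulc _)) (hmulc s)]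
      _ = _ := by rw [hμ₁inv s hsdet]
  have hae : ∀ᵐ x ∂D, x ≠ 0 := ae_ne_zero_field μF
  have hK : Measurable fun x => ∫⁻ h, Q (t1Arch F n x * h) ∂μ₁ := by
    have : Measurable fun p : F × Matrix (Fin n) (Fin n) F => Q (t1Arch F n p.1 * p.2) :=
      hQ.comp ((continuous_t1Arch.comp continuous_fst).matrix_mul continuous_snd).measurable
    exact this.lintegral_prod_right'
  calc _ = ∫⁻ x, ∫⁻ h, Q (t1Arch F n (δ * x) * h) ∂μ₁ ∂D := by
        refine lintegral_congr_ae ?_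
        filter_upwards [hae] with x hx using hinner x hx
    _ = ∫⁻ x, ∫⁻ h, Q (t1Arch F n x * h) ∂μ₁ ∂(Measure.map (fun x => δ * x) D) := by
        rw [lintegral_map hK (measurable_const_mul δ)]
    _ = _ := by rw [map_mul_left_field μF hy]

theorem ae_det_ne_zero_muGLArch [Nonempty (Fin n)] (μp : Measure (Matrix (Fin n) (Fin n) F)) :
    ∀ᵐ y ∂(muGLArch F n μp), y.det ≠ 0 := by
  rw [muGLArch, ae_withDensity_iff measurable_density]
  refine Filter.Eventually.of_forall fun x hx hx0 => hx ?_
  have hn : n ≠ 0 := (Fin.pos_iff_nonempty.2 ‹_›).ne'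
  simp [hx0, absNorm_eq_zero_iff.2 rfl, hn]

theorem measurable_matrix_inv :
    Measurable fun g : Matrix (Fin n) (Fin n) F => g⁻¹ := by
  let : MeasurableSpace F := borel F
  have : BorelSpace F := ⟨rfl⟩
  have h : ∀ g : Matrix (Fin n) (Fin n) F, g⁻¹ = g.det⁻¹ • g.adjugate := fun g => by
    rw [inv_def, Ring.inverse_eq_inv']
  simp only [h]
  have h1 : Measurable fun g : Matrix (Fin n) (Fin n) F => g.det⁻¹ :=
    (continuous_id.matrix_det).measurable.inv
  have h2 : Measurable fun g : Matrix (Fin n) (Fin n) F => g.adjugate :=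
    (continuous_id.matrix_adjugate).measurable
  have h3 : Continuous fun p : F × Matrix (Fin n) (Fin n) F => p.1 • p.2 := continuous_smul
  exact h3.measurable.comp (h1.prodMk h2)

instance instSecondCountable_matrix : SecondCountableTopology (Matrix (Fin n) (Fin n) F) :=
  inferInstanceAs (SecondCountableTopology (Fin n → Fin n → F))

theorem measure_mul_le_lintegral_muGLArch
    (μp : Measure (Matrix (Fin n) (Fin n) F)) [hμ : μp.IsAddHaarMeasure]
    {H H' : Matrix (Fin n) (Fin n) F → ENNReal}
    {B : Set (Matrix (Fin n) (Fin n) F)} (hB : MeasurableSet B)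
    (hHB : ∀ w : Matrix (Fin n) (Fin n) F, w.det ≠ 0 → ∀ b ∈ B, H w ≤ H' (w * b))
    {v : Matrix (Fin n) (Fin n) F} (hv : v.det ≠ 0) :
    muGLArch F n μp B * H v ≤ ∫⁻ y, H' y * B.indicator 1 (v⁻¹ * y) ∂(muGLArch F n μp) := by
  have hvinv : (v⁻¹).det ≠ 0 := by
    rw [det_nonsing_inv, Ring.inverse_eq_inv']; exact inv_ne_zero hv
  have hu : IsUnit v.det := isUnit_iff_ne_zero.2 hv
  have hmv : Measurable fun y => v⁻¹ * y :=
    (continuous_const.matrix_mul continuous_id).measurable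
  have hI : Measurable (B.indicator (1 : Matrix (Fin n) (Fin n) F → ENNReal)) :=
    measurable_one.indicator hB
  set Λ := muGLArch F n μp
  calc Λ B * H v = (∫⁻ y, B.indicator 1 y ∂Λ) * H v := by rw [lintegral_indicator_one hB]
    _ = (∫⁻ y, B.indicator 1 y ∂(Measure.map (fun y => v⁻¹ * y) Λ)) * H v := by
      rw [map_mul_left_muGLArch μp hvinv]
    _ = (∫⁻ y, B.indicator 1 (v⁻¹ * y) ∂Λ) * H v := by rw [lintegral_map hI hmv]
    _ = ∫⁻ y, B.indicator 1 (v⁻¹ * y) * H v ∂Λ :=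
      (lintegral_mul_const _ (hI.comp hmv)).symm
    _ ≤ _ := by
      refine lintegral_mono fun y => ?_
      by_cases hy : v⁻¹ * y ∈ B
      · have := hHB v hv _ hy
        rw [mul_nonsing_inv_cancel_left _ _ hu] at this
        simpa [Set.indicator_of_mem hy] using this
      · simp [Set.indicator_of_notMem hy]

/-- Comparison of the measure `d^×x d₁h` on `GL_n(F)` with the Haar measure `d⁺y / |det y|_F^n`. -/
theorem lintegral_t1Arch_comparison [MeasurableSpace F] [BorelSpace F] (hn : 1 ≤ n)
    (μp : Measure (Matrix (Fin n) (Fin n) F)) [hμ : μp.IsAddHaarMeasure] [SFinite μp]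
    (μ₁ : Measure (Matrix (Fin n) (Fin n) F)) [SFinite μ₁]
    (hμ₁supp : μ₁ {h | h.det ≠ 1} = 0)
    (hμ₁inv : ∀ s : Matrix (Fin n) (Fin n) F, s.det = 1 →
      Measure.map (fun h => s * h) μ₁ = μ₁)
    (μF : Measure F) [μF.IsAddHaarMeasure]
    {H H' : Matrix (Fin n) (Fin n) F → ENNReal} (hH' : Measurable H')
    {B : Set (Matrix (Fin n) (Fin n) F)} (hB : MeasurableSet B)
    (hHB : ∀ w : Matrix (Fin n) (Fin n) F, w.det ≠ 0 → ∀ b ∈ B, H w ≤ H' (w * b)) :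
    muGLArch F n μp B * ∫⁻ x, ∫⁻ h, H (t1Arch F n x * h) ∂μ₁
        ∂(μF.withDensity fun x => ENNReal.ofReal (absNorm F x)⁻¹) ≤
      (∫⁻ x, ∫⁻ h, B.indicator 1 (t1Arch F n x * h)⁻¹ ∂μ₁
        ∂(μF.withDensity fun x => ENNReal.ofReal (absNorm F x)⁻¹)) *
      ∫⁻ y, H' y ∂(muGLArch F n μp) := by
  obtain ⟨I, hIdef⟩ : ∃ I : Matrix (Fin n) (Fin n) F → ENNReal, I = B.indicator 1 := ⟨_, rfl⟩
  have hI : Measurable I := by rw [hIdef]; exact measurable_one.indicator hB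
  rw [← hIdef]
  have : Nonempty (Fin n) := Fin.pos_iff_nonempty.1 hn
  set D := μF.withDensity fun x => ENNReal.ofReal (absNorm F x)⁻¹ with hD
  set Λ := muGLArch F n μp with hΛ
  have : SFinite Λ := by rw [hΛ, muGLArch]; infer_instance
  obtain ⟨w, hwdef⟩ : ∃ w : F × Matrix (Fin n) (Fin n) F → Matrix (Fin n) (Fin n) F,
      w = fun p => t1Arch F n p.1 * p.2 := ⟨_, rfl⟩
  have hw : Measurable w := by
    rw [hwdef]
    exact ((continuous_t1Arch.comp continuous_fst).matrix_mul continuous_snd).measurable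
  have hae : ∀ᵐ x ∂D, x ≠ 0 := ae_ne_zero_field μF
  have hae1 : ∀ᵐ h ∂μ₁, h.det = 1 := hμ₁supp
  have hmul : Measurable fun p : Matrix (Fin n) (Fin n) F × Matrix (Fin n) (Fin n) F =>
    p.1 * p.2 := (continuous_fst.matrix_mul continuous_snd).measurable
  have hpoint : ∀ v : Matrix (Fin n) (Fin n) F, v.det ≠ 0 →
      Λ B * H v ≤ ∫⁻ y, H' y * I (v⁻¹ * y) ∂Λ := fun v hv => by
    rw [hIdef]
    exact measure_mul_le_lintegral_muGLArch μp hB hHB hv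
  have hdiv : Measurable fun q : Matrix (Fin n) (Fin n) F × Matrix (Fin n) (Fin n) F =>
      q.1⁻¹ * q.2 :=
    hmul.comp ((measurable_matrix_inv.comp measurable_fst).prodMk measurable_snd)
  have hIdiv : Measurable fun q : Matrix (Fin n) (Fin n) F × Matrix (Fin n) (Fin n) F =>
      I (q.1⁻¹ * q.2) := hI.comp hdiv
  have hjoint : Measurable (Function.uncurry fun (p : F × Matrix (Fin n) (Fin n) F)
      (y : Matrix (Fin n) (Fin n) F) =>
      H' y * I ((w p)⁻¹ * y)) := by
    have h1 : Measurable fun q : (F × Matrix (Fin n) (Fin n) F) × Matrix (Fin n) (Fin n) F =>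
        (w q.1, q.2) := (hw.comp measurable_fst).prodMk measurable_snd
    have h2 : Measurable fun q : (F × Matrix (Fin n) (Fin n) F) × Matrix (Fin n) (Fin n) F =>
        H' q.2 := hH'.comp measurable_snd
    have h3 : Measurable fun q : (F × Matrix (Fin n) (Fin n) F) × Matrix (Fin n) (Fin n) F =>
        I ((w q.1)⁻¹ * q.2) := by
      have := hIdiv.comp h1
      exact this
    exact h2.mul h3
  have hA : ∀ y : Matrix (Fin n) (Fin n) F, y.det ≠ 0 →
      ∫⁻ p, I ((w p)⁻¹ * y) ∂(D.prod μ₁) =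
      ∫⁻ x, ∫⁻ h, I (t1Arch F n x * h)⁻¹ ∂μ₁ ∂D := by
    intro y hy
    have hyinv : (y⁻¹).det ≠ 0 := by
      rw [det_nonsing_inv, Ring.inverse_eq_inv']; exact inv_ne_zero hy
    have hu : IsUnit y.det := isUnit_iff_ne_zero.2 hy
    have hm : Measurable fun p => I
        ((w p)⁻¹ * y) := by
      have := hIdiv.comp (hw.prodMk (measurable_const (a := y)))
      exact this
    have hrev : ∀ v : Matrix (Fin n) (Fin n) F, v⁻¹ * y = (y⁻¹ * v)⁻¹ := fun v => by
      rw [Matrix.mul_inv_rev, nonsing_inv_nonsing_inv y hu]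
    calc ∫⁻ p, I ((w p)⁻¹ * y) ∂(D.prod μ₁)
        = ∫⁻ x, ∫⁻ h, I ((w (x, h))⁻¹ * y) ∂μ₁ ∂D :=
          lintegral_prod _ hm.aemeasurable
      _ = ∫⁻ x, ∫⁻ h, I (y⁻¹ * (t1Arch F n x * h))⁻¹ ∂μ₁ ∂D := by
          simp only [hrev, hwdef]
      _ = _ := lintegral_prod_t1Arch_mul_left hn μ₁ hμ₁inv μF
          (Q := fun v => I v⁻¹) (hI.comp measurable_matrix_inv) hyinv
  calc Λ B * ∫⁻ x, ∫⁻ h, H (t1Arch F n x * h) ∂μ₁ ∂D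
      ≤ ∫⁻ x, ∫⁻ h, Λ B * H (t1Arch F n x * h) ∂μ₁ ∂D := by
        refine (lintegral_const_mul_le _ _).trans (lintegral_mono fun x => ?_)
        exact lintegral_const_mul_le _ _
    _ ≤ ∫⁻ x, ∫⁻ h, ∫⁻ y, H' y * I ((w (x, h))⁻¹ * y) ∂Λ ∂μ₁ ∂D := by
        refine lintegral_mono_ae ?_
        filter_upwards [hae] with x hx
        refine lintegral_mono_ae ?_
        filter_upwards [hae1] with h hh
        have := hpoint (w (x, h)) ?_
        · rwa [hwdef] at this ⊢
        rw [hwdef, det_mul, det_t1Arch hn, hh, mul_one]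
        exact hx
    _ = ∫⁻ p, ∫⁻ y, H' y * I ((w p)⁻¹ * y) ∂Λ ∂(D.prod μ₁) :=
        (lintegral_prod _ hjoint.lintegral_prod_right.aemeasurable).symm
    _ = ∫⁻ y, ∫⁻ p, H' y * I ((w p)⁻¹ * y) ∂(D.prod μ₁) ∂Λ :=
        lintegral_lintegral_swap hjoint.aemeasurable
    _ = ∫⁻ y, H' y * ∫⁻ x, ∫⁻ h, I (t1Arch F n x * h)⁻¹ ∂μ₁ ∂D ∂Λ := by
        refine lintegral_congr_ae ?_
        filter_upwards [ae_det_ne_zero_muGLArch μp] with y hy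
        rw [← hA y hy, lintegral_const_mul]
        have := hIdiv.comp (hw.prodMk (measurable_const (a := y)))
        exact this
    _ = _ := by rw [lintegral_mul_const _ hH', mul_comm]

/-- The set of matrices used as a window around the identity when comparing measures. -/
def detWindow (F : Type*) [RCLike F] (n : ℕ) : Set (Matrix (Fin n) (Fin n) F) :=
  {b | entryNorm b ≤ 2 ∧ 1 / 2 ≤ ‖b.det‖}

theorem measurableSet_detWindow : MeasurableSet (detWindow F n) := by
  refine IsClosed.measurableSet (IsClosed.inter ?_ ?_)
  · exact isClosed_le continuous_entryNorm continuous_const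
  · exact isClosed_le continuous_const continuous_id.matrix_det.norm

theorem muGLArch_detWindow_ne_zero (μp : Measure (Matrix (Fin n) (Fin n) F))
    [hμ : μp.IsAddHaarMeasure] : muGLArch F n μp (detWindow F n) ≠ 0 := by
  rw [muGLArch, Ne, withDensity_apply_eq_zero measurable_density]
  refine (IsOpen.measure_pos μp (U := {b : Matrix (Fin n) (Fin n) F |
    entryNorm b < 2 ∧ 1 / 2 < ‖b.det‖}) ?_ ⟨1, ?_, ?_⟩).ne' ∘ fun h => measure_mono_null ?_ h
  · exact (isOpen_lt continuous_entryNorm continuous_const).inter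
      (isOpen_lt continuous_const continuous_id.matrix_det.norm)
  · refine (entryNorm_le zero_le_one fun i j => ?_).trans_lt one_lt_two
    rw [one_apply]
    split_ifs <;> simp
  · simp; norm_num
  · rintro b ⟨h1, h2⟩
    have hb : b.det ≠ 0 := by rw [← norm_pos_iff]; linarith
    refine ⟨?_, h1.le, h2.le⟩
    have := absNorm_pos hb
    simp only [Set.mem_ofPred_eq, ne_eq, ENNReal.ofReal_eq_zero, not_le]
    positivity

theorem lintegral_detWindow_inv_lt_top [MeasurableSpace F] [BorelSpace F] (hn : 1 ≤ n)
    (μ₁ : Measure (Matrix (Fin n) (Fin n) F))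
    (hμ₁supp : μ₁ {h | h.det ≠ 1} = 0)
    (hμ₁fin : ∀ K : Set (Matrix (Fin n) (Fin n) F), IsCompact K → μ₁ K < ⊤)
    (μF : Measure F) [μF.IsAddHaarMeasure] :
    ∫⁻ x, ∫⁻ h, (detWindow F n).indicator 1 (t1Arch F n x * h)⁻¹ ∂μ₁
        ∂(μF.withDensity fun x => ENNReal.ofReal (absNorm F x)⁻¹) < ⊤ := by
  obtain ⟨R, hR⟩ : ∃ R : ℝ, R = n.factorial * (1 + 2) ^ n := ⟨_, rfl⟩
  have hR1 : 1 ≤ R := by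
    rw [hR]
    have h1 : (1:ℝ) ≤ n.factorial := by exact_mod_cast Nat.one_le_iff_ne_zero.2 n.factorial_ne_zero
    exact one_le_mul_of_one_le_of_one_le h1 (one_le_pow₀ (by norm_num))
  have hR0 : 0 < R := by linarith
  obtain ⟨r, hr⟩ : ∃ r : ℝ, r = n * ((1 + R) * (2 * R)) := ⟨_, rfl⟩
  obtain ⟨I, hIdef⟩ : ∃ I : Matrix (Fin n) (Fin n) F → ENNReal,
    I = (detWindow F n).indicator 1 := ⟨_, rfl⟩
  rw [← hIdef]
  have hKx : MeasurableSet {x : F | R⁻¹ ≤ ‖x‖ ∧ ‖x‖ ≤ 2} :=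
    ((isClosed_le continuous_const continuous_norm).inter
      (isClosed_le continuous_norm continuous_const)).measurableSet
  have hKh : MeasurableSet {h : Matrix (Fin n) (Fin n) F | entryNorm h ≤ r} :=
    (isClosed_le continuous_entryNorm continuous_const).measurableSet
  have hwin : ∀ x : F, x ≠ 0 → ∀ h : Matrix (Fin n) (Fin n) F, h.det = 1 →
      (t1Arch F n x * h)⁻¹ ∈ detWindow F n → (R⁻¹ ≤ ‖x‖ ∧ ‖x‖ ≤ 2) ∧ entryNorm h ≤ r := by
    intro x hx h hh hmem
    obtain ⟨b, hb⟩ : ∃ b, b = (t1Arch F n x * h)⁻¹ := ⟨_, rfl⟩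
    rw [← hb] at hmem
    obtain ⟨hb2, hbd⟩ := hmem
    have hx0 : 0 < ‖x‖ := norm_pos_iff.2 hx
    have hwdet : (t1Arch F n x * h).det = x := by rw [det_mul, det_t1Arch hn, hh, mul_one]
    have hbdet : b.det = x⁻¹ := by rw [hb, det_nonsing_inv, Ring.inverse_eq_inv', hwdet]
    have hx2 : ‖x‖ ≤ 2 := by
      rw [hbdet, norm_inv, one_div] at hbd
      exact (inv_le_inv₀ two_pos hx0).1 hbd
    have hbR : ∀ c : ℝ, c ≤ n.factorial * (1 + entryNorm b) ^ n → c ≤ R := fun c hc => by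
      refine hc.trans ?_
      rw [hR]
      have := entryNorm_nonneg b
      gcongr
    have hxR : ‖x‖⁻¹ ≤ R := by
      have := hbR _ (norm_det_le b)
      rwa [hbdet, norm_inv] at this
    have hu : IsUnit (t1Arch F n x * h).det := by rw [hwdet]; exact isUnit_iff_ne_zero.2 hx
    have hheq : h = t1Arch F n x⁻¹ * (x • b.adjugate) := by
      have h1 : t1Arch F n x * h = x • b.adjugate := by
        have h3 : b⁻¹ = t1Arch F n x * h := by rw [hb, nonsing_inv_nonsing_inv _ hu]
        rw [← h3, inv_def, Ring.inverse_eq_inv', hbdet, inv_inv]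
      rw [← h1, ← Matrix.mul_assoc, ← t1Arch_mul, inv_mul_cancel₀ hx, t1Arch_one, Matrix.one_mul]
    refine ⟨⟨?_, hx2⟩, ?_⟩
    · rw [inv_le_comm₀ hR0 hx0]; exact hxR
    · rw [hheq, hr]
      refine (entryNorm_mul_le _ _).trans ?_
      have e1 : entryNorm (t1Arch F n x⁻¹) ≤ 1 + R :=
        (entryNorm_t1Arch_le _).trans (by rw [norm_inv]; linarith)
      have e2 : entryNorm (x • b.adjugate) ≤ 2 * R := by
        refine entryNorm_le (by positivity) fun i j => ?_
        rw [Matrix.smul_apply, smul_eq_mul, norm_mul]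
        exact mul_le_mul hx2 (hbR _ ((norm_entry_le _ _ _).trans (entryNorm_adjugate_le b)))
          (norm_nonneg _) two_pos.le
      have := entryNorm_nonneg (x • b.adjugate)
      gcongr
  have hae1 : ∀ᵐ h ∂μ₁, h.det = 1 := hμ₁supp
  obtain ⟨Kx, hKxdef⟩ : ∃ Kx : Set F, Kx = {x : F | R⁻¹ ≤ ‖x‖ ∧ ‖x‖ ≤ 2} := ⟨_, rfl⟩
  obtain ⟨Kh, hKhdef⟩ : ∃ Kh : Set (Matrix (Fin n) (Fin n) F), Kh = {h | entryNorm h ≤ r} :=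
    ⟨_, rfl⟩
  rw [← hKxdef] at hKx
  rw [← hKhdef] at hKh
  have hKhfin : μ₁ Kh < ⊤ := hμ₁fin _ (hKhdef ▸ isCompact_entryNorm_le r)
  set D := μF.withDensity fun x => ENNReal.ofReal (absNorm F x)⁻¹ with hD
  have hKxfin : D Kx < ⊤ := by
    rw [hD, withDensity_apply _ hKx]
    calc ∫⁻ x in Kx, ENNReal.ofReal (absNorm F x)⁻¹ ∂μF
        ≤ ∫⁻ _ in Kx, ENNReal.ofReal (R ^ Module.finrank ℝ F) ∂μF := by
          refine setLIntegral_mono' hKx fun x hx => ENNReal.ofReal_le_ofReal ?_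
          rw [hKxdef] at hx
          have hx0 : 0 < ‖x‖ := (inv_pos.2 hR0).trans_le hx.1
          rw [absNorm, ← inv_pow]
          gcongr
          exact (inv_le_comm₀ hR0 hx0).1 hx.1
      _ < ⊤ := by
          rw [setLIntegral_const]
          refine ENNReal.mul_lt_top ENNReal.ofReal_lt_top ?_
          refine (measure_mono fun x hx => ?_).trans_lt
            (isCompact_closedBall (0 : F) 2).measure_lt_top
          rw [hKxdef] at hx
          simpa using hx.2
  calc ∫⁻ x, ∫⁻ h, I (t1Arch F n x * h)⁻¹ ∂μ₁ ∂D
      ≤ ∫⁻ x, ∫⁻ h, Kx.indicator 1 x * Kh.indicator 1 h ∂μ₁ ∂D := by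
        refine lintegral_mono_ae ?_
        filter_upwards [ae_ne_zero_field μF] with x hx
        refine lintegral_mono_ae ?_
        filter_upwards [hae1] with h hh
        by_cases hmem : (t1Arch F n x * h)⁻¹ ∈ detWindow F n
        · obtain ⟨h1, h2⟩ := hwin x hx h hh hmem
          rw [hIdef, hKxdef, hKhdef, Set.indicator_of_mem hmem,
            Set.indicator_of_mem (show x ∈ {x : F | R⁻¹ ≤ ‖x‖ ∧ ‖x‖ ≤ 2} from h1),
            Set.indicator_of_mem (show h ∈ {h | entryNorm h ≤ r} from h2)]
          simp
        · rw [hIdef, Set.indicator_of_notMem hmem]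
          exact zero_le
    _ = D Kx * μ₁ Kh := by
        simp only [lintegral_const_mul _ (measurable_one.indicator hKh),
          lintegral_indicator_one hKh]
        rw [lintegral_mul_const _ (measurable_one.indicator hKx), lintegral_indicator_one hKx]
    _ < ⊤ := ENNReal.mul_lt_top hKxfin hKhfin

theorem measurable_det_rpow_mul (τ C : ℝ) (k : ℕ) :
    Measurable fun y : Matrix (Fin n) (Fin n) F =>
      ENNReal.ofReal (C * (‖y.det‖ ^ τ * ((1 + entryNorm y) ^ k)⁻¹)) := by
  have h1 : Measurable fun y : Matrix (Fin n) (Fin n) F => ‖y.det‖ :=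
    continuous_id.matrix_det.norm.measurable
  have h2 : Measurable fun y : Matrix (Fin n) (Fin n) F => entryNorm y :=
    continuous_entryNorm.measurable
  exact (((h1.pow_const τ).mul ((h2.const_add 1).pow_const k).inv).const_mul C).ennreal_ofReal

theorem lintegral_one_add_entryNorm_lt_top (μp : Measure (Matrix (Fin n) (Fin n) F))
    [hμ : μp.IsAddHaarMeasure] :
    ∃ m : ℕ, ∫⁻ y, ENNReal.ofReal ((1 + entryNorm y) ^ m)⁻¹ ∂μp < ⊤ := by
  refine ⟨Module.finrank ℝ (Fin n → Fin n → F) + 1, ?_⟩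
  have h := @finite_integral_one_add_norm (Fin n → Fin n → F) _ _ _ mm bm μp hμ
    ((Module.finrank ℝ (Fin n → Fin n → F) + 1 : ℕ) : ℝ) (by simp)
  simp only [Real.rpow_neg (add_nonneg zero_le_one (norm_nonneg _)), Real.rpow_natCast] at h
  exact h

theorem lintegral_muGLArch_lt_top (μp : Measure (Matrix (Fin n) (Fin n) F))
    [hμ : μp.IsAddHaarMeasure] {τ : ℝ} (hτ : (Module.finrank ℝ F * n : ℕ) ≤ τ) :
    ∃ k : ℕ, ∀ C : ℝ, 0 ≤ C → ∫⁻ y, ENNReal.ofReal (C * (‖y.det‖ ^ τ * ((1 + entryNorm y) ^ k)⁻¹))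
      ∂(muGLArch F n μp) < ⊤ := by
  obtain ⟨m, hm⟩ := lintegral_one_add_entryNorm_lt_top μp
  obtain ⟨l, hl⟩ := exists_nat_ge (τ - (Module.finrank ℝ F * n : ℕ))
  refine ⟨n * l + m, fun C hC => ?_⟩
  obtain ⟨A, hA⟩ : ∃ A : ℝ, A = C * (2 * n.factorial) ^ l := ⟨_, rfl⟩
  have hA0 : 0 ≤ A := by rw [hA]; positivity
  have key : ∀ y : Matrix (Fin n) (Fin n) F, (absNorm F y.det ^ n)⁻¹ *
      (C * (‖y.det‖ ^ τ * ((1 + entryNorm y) ^ (n * l + m))⁻¹)) ≤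
      A * ((1 + entryNorm y) ^ m)⁻¹ := by
    intro y
    have he := entryNorm_nonneg y
    have h1 : (absNorm F y.det ^ n)⁻¹ * ‖y.det‖ ^ τ ≤
        (2 * n.factorial) ^ l * (1 + entryNorm y) ^ (n * l) := by
      rcases (norm_nonneg y.det).eq_or_lt with h0 | h0
      · have hτ0 : 0 ≤ τ := le_trans (Nat.cast_nonneg _) hτ
        rcases hτ0.eq_or_lt with h00 | h00
        · rw [← h00] at hτ
          have : Module.finrank ℝ F * n = 0 := by
            have := le_antisymm hτ (Nat.cast_nonneg _)
            exact_mod_cast this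
          rw [absNorm, ← pow_mul, this, ← h00]
          simp only [pow_zero, inv_one, Real.rpow_zero, mul_one]
          have h1 : (1:ℝ) ≤ 2 * n.factorial := by
            have : (1:ℝ) ≤ n.factorial := by
              exact_mod_cast Nat.one_le_iff_ne_zero.2 n.factorial_ne_zero
            linarith
          exact one_le_mul_of_one_le_of_one_le (one_le_pow₀ h1) (one_le_pow₀ (by linarith))
        · rw [← h0, Real.zero_rpow h00.ne', mul_zero]
          positivity
      · rw [absNorm, ← pow_mul, ← Real.rpow_natCast, ← Real.rpow_neg h0.le, ← Real.rpow_add h0]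
        calc ‖y.det‖ ^ (-((Module.finrank ℝ F * n : ℕ) : ℝ) + τ)
            ≤ (1 + ‖y.det‖) ^ (-((Module.finrank ℝ F * n : ℕ) : ℝ) + τ) :=
              Real.rpow_le_rpow h0.le (by linarith) (by linarith)
          _ ≤ (1 + ‖y.det‖) ^ (l : ℝ) :=
              Real.rpow_le_rpow_of_exponent_le (by linarith) (by linarith)
          _ = (1 + ‖y.det‖) ^ l := Real.rpow_natCast _ _
          _ ≤ (2 * n.factorial * (1 + entryNorm y) ^ n) ^ l := by
              have h2 := norm_det_le y
              have h3 : (1:ℝ) ≤ n.factorial * (1 + entryNorm y) ^ n := by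
                have h1 : (1:ℝ) ≤ n.factorial := by
                  exact_mod_cast Nat.one_le_iff_ne_zero.2 n.factorial_ne_zero
                exact one_le_mul_of_one_le_of_one_le h1 (one_le_pow₀ (by linarith))
              gcongr
              linarith
          _ = _ := by rw [mul_pow, ← pow_mul]
    calc _ = (C * ((1 + entryNorm y) ^ (n * l + m))⁻¹) *
            ((absNorm F y.det ^ n)⁻¹ * ‖y.det‖ ^ τ) := by ring
      _ ≤ (C * ((1 + entryNorm y) ^ (n * l + m))⁻¹) *
            ((2 * n.factorial) ^ l * (1 + entryNorm y) ^ (n * l)) := by gcongr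
      _ = _ := by
        have : (1 + entryNorm y) ^ (n * l) ≠ 0 := by positivity
        rw [hA, pow_add, mul_inv]
        field_simp
  rw [muGLArch, lintegral_withDensity_eq_lintegral_mul₀' measurable_density.aemeasurable]
  · calc _ ≤ ∫⁻ y, ENNReal.ofReal A * ENNReal.ofReal ((1 + entryNorm y) ^ m)⁻¹ ∂μp := by
          refine lintegral_mono fun y => ?_
          rw [Pi.mul_apply, ← ENNReal.ofReal_mul (inv_nonneg.2 (pow_nonneg (absNorm_nonneg _) _)),
            ← ENNReal.ofReal_mul hA0]
          exact ENNReal.ofReal_le_ofReal (key y)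
      _ < ⊤ := by
          rw [lintegral_const_mul' _ _ ENNReal.ofReal_ne_top]
          exact ENNReal.mul_lt_top ENNReal.ofReal_lt_top hm
  · exact (measurable_det_rpow_mul τ C _).aemeasurable

theorem exists_lintegral_t1Arch_lt_top [MeasurableSpace F] [BorelSpace F] (hn : 1 ≤ n)
    (μp : Measure (Matrix (Fin n) (Fin n) F)) [hμ : μp.IsAddHaarMeasure] [SFinite μp]
    (μ₁ : Measure (Matrix (Fin n) (Fin n) F)) [SFinite μ₁]
    (hμ₁supp : μ₁ {h | h.det ≠ 1} = 0)
    (hμ₁inv : ∀ s : Matrix (Fin n) (Fin n) F, s.det = 1 →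
      Measure.map (fun h => s * h) μ₁ = μ₁)
    (hμ₁fin : ∀ K : Set (Matrix (Fin n) (Fin n) F), IsCompact K → μ₁ K < ⊤)
    (μF : Measure F) [μF.IsAddHaarMeasure]
    {τ : ℝ} (hτ : (Module.finrank ℝ F * n : ℕ) ≤ τ) :
    ∃ k : ℕ, ∫⁻ x, ∫⁻ h, ENNReal.ofReal (‖(t1Arch F n x * h).det‖ ^ τ *
        ((1 + entryNorm (t1Arch F n x * h)) ^ k)⁻¹) ∂μ₁
        ∂(μF.withDensity fun x => ENNReal.ofReal (absNorm F x)⁻¹) < ⊤ := by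
  obtain ⟨k, hk⟩ := lintegral_muGLArch_lt_top μp hτ
  refine ⟨k, ?_⟩
  have hτ0 : 0 ≤ τ := le_trans (Nat.cast_nonneg _) hτ
  obtain ⟨C, hC⟩ : ∃ C : ℝ, C = 2 ^ τ * (2 * n + 1) ^ k := ⟨_, rfl⟩
  have hC0 : 0 ≤ C := by rw [hC]; positivity
  have hcomp := lintegral_t1Arch_comparison hn μp μ₁ hμ₁supp hμ₁inv μF
    (H := fun w => ENNReal.ofReal (‖w.det‖ ^ τ * ((1 + entryNorm w) ^ k)⁻¹))
    (H' := fun y => ENNReal.ofReal (C * (‖y.det‖ ^ τ * ((1 + entryNorm y) ^ k)⁻¹)))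
    (measurable_det_rpow_mul τ C k) measurableSet_detWindow ?_
  · refine (ENNReal.lt_top_of_mul_ne_top_right
      (hcomp.trans_lt (ENNReal.mul_lt_top ?_ (hk C hC0))).ne (muGLArch_detWindow_ne_zero μp))
    exact lintegral_detWindow_inv_lt_top hn μ₁ hμ₁supp hμ₁fin μF
  · rintro w - b ⟨hb2, hbd⟩
    refine ENNReal.ofReal_le_ofReal ?_
    have hw := entryNorm_nonneg w
    have hwb := entryNorm_nonneg (w * b)
    have hdet : ‖w.det‖ ≤ 2 * ‖(w * b).det‖ := by
      rw [det_mul, norm_mul]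
      nlinarith [norm_nonneg w.det]
    have hent : 1 + entryNorm (w * b) ≤ (2 * n + 1) * (1 + entryNorm w) := by
      have h1 := entryNorm_mul_le w b
      have h2 : (n : ℝ) * (entryNorm w * entryNorm b) ≤ n * (entryNorm w * 2) := by gcongr
      have h3 : (0:ℝ) ≤ n := Nat.cast_nonneg n
      nlinarith
    calc ‖w.det‖ ^ τ * ((1 + entryNorm w) ^ k)⁻¹
        ≤ (2 * ‖(w * b).det‖) ^ τ * ((2 * n + 1) ^ k * ((1 + entryNorm (w * b)) ^ k)⁻¹) := by
          refine mul_le_mul (Real.rpow_le_rpow (norm_nonneg _) hdet hτ0) ?_ (by positivity)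
            (by positivity)
          rw [← div_eq_mul_inv, inv_le_comm₀ (by positivity) (by positivity), inv_div,
            div_le_iff₀ (by positivity), mul_comm ((1 + entryNorm w) ^ k), ← mul_pow]
          gcongr
      _ = _ := by
          rw [Real.mul_rpow two_pos.le (norm_nonneg _), hC]
          ring

theorem convGJArch_eq (μp : Measure (Matrix (Fin n) (Fin n) F)) [hμ : μp.IsAddHaarMeasure]
    (c : Matrix (Fin n) (Fin n) F → ℂ) {g : Matrix (Fin n) (Fin n) F} (hg : g.det ≠ 0) :
    convGJArch F n μp c g = ((absNorm F g.det ^ ((n : ℝ) / 2) : ℝ) : ℂ) *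
      ∫ v, psiArch F (g * v).trace * detTwist F n c v ∂μp := by
  have hu : IsUnit g.det := isUnit_iff_ne_zero.2 hg
  have hemb : MeasurableEmbedding fun h => g * h := by
    refine (Homeomorph.measurableEmbedding (⟨⟨fun h => g * h, fun h => g⁻¹ * h, fun h => ?_,
      fun h => ?_⟩, ?_, ?_⟩ : Matrix (Fin n) (Fin n) F ≃ₜ Matrix (Fin n) (Fin n) F))
    · exact nonsing_inv_mul_cancel_left _ _ hu
    · exact mul_nonsing_inv_cancel_left _ _ hu
    · exact continuous_const.matrix_mul continuous_id
    · exact continuous_const.matrix_mul continuous_id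
  rw [convGJArch, ← map_mul_left_muGLArch μp hg, hemb.integral_map, muGLArch,
    integral_withDensity_eq_integral_toReal_smul₀ measurable_density.aemeasurable
      (Filter.Eventually.of_forall fun _ => ENNReal.ofReal_lt_top), ← integral_const_mul]
  refine integral_congr_ae (Filter.Eventually.of_forall fun v => ?_)
  have hpos := absNorm_nonneg (F := F)
  simp only [PhiGJArch, detTwist]
  rw [nonsing_inv_mul_cancel_left _ _ hu, ENNReal.toReal_ofReal (inv_nonneg.2 (pow_nonneg
    (hpos _) _)), det_mul, absNorm_mul, Real.mul_rpow (hpos _) (hpos _), Complex.real_smul]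
  push_cast
  simp only [show Matrix.of v = v from rfl]
  ring

theorem exists_convGJArch_decay (μp : Measure (Matrix (Fin n) (Fin n) F))
    [hμ : μp.IsAddHaarMeasure] {c : Matrix (Fin n) (Fin n) F → ℂ}
    (hc : ContDiff ℝ (⊤ : ℕ∞) (fun g : Fin n → Fin n → F => c (Matrix.of g)))
    (hcs : HasCompactSupport (fun g : Fin n → Fin n → F => c (Matrix.of g)))
    (hcd : tsupport (fun g : Fin n → Fin n → F => c (Matrix.of g))
          ⊆ {g : Fin n → Fin n → F | (Matrix.of g).det ≠ 0}) :
    ∃ Ψ : Matrix (Fin n) (Fin n) F → ℂ, Continuous Ψ ∧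
      (∀ M : ℕ, ∃ C : ℝ, ∀ g, ‖Ψ g‖ * (1 + entryNorm g) ^ M ≤ C) ∧
      ∀ g, g.det ≠ 0 → convGJArch F n μp c g =
        ((absNorm F g.det ^ ((n : ℝ) / 2) : ℝ) : ℂ) * Ψ g := by
  have h := @continuous_fourierIntegral_and_decay (Fin n → Fin n → F) _ _ _ mm bm
    (Fin n → Fin n → F) _ _ μp hμ (negTraceForm F n) exists_norm_le_negTraceForm _
    (contDiff_detTwist hc hcd) (hasCompactSupport_detTwist hcs)
  simp only [fourierChar_neg_negTraceForm] at h
  exact ⟨fun g => ∫ v, psiArch F (g * v).trace * detTwist F n c v ∂μp, h.1, h.2,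
    fun g hg => convGJArch_eq μp c hg⟩

instance instSigmaCompactSpace_matrix : SigmaCompactSpace (Matrix (Fin n) (Fin n) F) :=
  inferInstanceAs (SigmaCompactSpace (Fin n → Fin n → F))

theorem integrable_det_rpow_mul [MeasurableSpace F] [BorelSpace F]
    (μ₁ : Measure (Matrix (Fin n) (Fin n) F)) [SFinite μ₁] (D : Measure F) {τ : ℝ} {k : ℕ}
    (hk : ∫⁻ x, ∫⁻ h, ENNReal.ofReal (‖(t1Arch F n x * h).det‖ ^ τ *
        ((1 + entryNorm (t1Arch F n x * h)) ^ k)⁻¹) ∂μ₁ ∂D < ⊤) :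
    Integrable (fun p : F × Matrix (Fin n) (Fin n) F => ‖(t1Arch F n p.1 * p.2).det‖ ^ τ *
        ((1 + entryNorm (t1Arch F n p.1 * p.2)) ^ k)⁻¹) (D.prod μ₁) := by
  have hw : Continuous fun p : F × Matrix (Fin n) (Fin n) F => t1Arch F n p.1 * p.2 :=
    (continuous_t1Arch.comp continuous_fst).matrix_mul continuous_snd
  have h1 : Measurable fun p : F × Matrix (Fin n) (Fin n) F => ‖(t1Arch F n p.1 * p.2).det‖ :=
    hw.matrix_det.norm.measurable
  have h2 : Measurable fun p : F × Matrix (Fin n) (Fin n) F =>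
      entryNorm (t1Arch F n p.1 * p.2) := (continuous_entryNorm.comp hw).measurable
  have hm : Measurable fun p : F × Matrix (Fin n) (Fin n) F =>
      ‖(t1Arch F n p.1 * p.2).det‖ ^ τ * ((1 + entryNorm (t1Arch F n p.1 * p.2)) ^ k)⁻¹ :=
    (h1.pow_const τ).mul ((h2.const_add 1).pow_const k).inv
  refine ⟨hm.aestronglyMeasurable, ?_⟩
  rw [hasFiniteIntegral_iff_ofReal (Filter.Eventually.of_forall fun p => by
    have := entryNorm_nonneg (t1Arch F n p.1 * p.2)
    positivity), lintegral_prod _ hm.ennreal_ofReal.aemeasurable]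
  exact hk

theorem aestronglyMeasurable_prod_of_continuousOn [MeasurableSpace F] [BorelSpace F]
    {ν : Measure (F × Matrix (Fin n) (Fin n) F)} {G : F × Matrix (Fin n) (Fin n) F → ℂ}
    (hν : ∀ᵐ p ∂ν, p.1 ≠ 0 ∧ p.2.det ≠ 0)
    (hG : ContinuousOn G {p | p.1 ≠ 0 ∧ p.2.det ≠ 0}) : AEStronglyMeasurable G ν := by
  have hS : IsOpen {p : F × Matrix (Fin n) (Fin n) F | p.1 ≠ 0 ∧ p.2.det ≠ 0} :=
    (isOpen_ne_fun continuous_fst continuous_const).inter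
      (isOpen_ne_fun continuous_snd.matrix_det continuous_const)
  rw [← Measure.restrict_eq_self_of_ae_mem hν]
  exact hG.aestronglyMeasurable hS.measurableSet

end Aux

/-- Fix `n ≥ 1` and `N ∈ ℕ`.  There exists a real number `s₀` (depending
only on `n` and `N`) such that for every smooth function `φ : GL_n(F) → ℂ` of moderate growth
of exponent `N`, every `c ∈ C_c^∞(GL_n(F))`, every unitary character `χ : Fˣ → ℂˣ`, and every
`s ∈ ℂ` with `Re(s) < s₀`, the Mellin transform
`∫_{Fˣ} k_{c,φ}(x)·χ(x)⁻¹·|x|_F^{-s} d^×x` converges absolutely, where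
`k_{c,φ}(x) = ∫_{SL_n(F)} (Φ_GJ * c^∨)(t₁(x)h)·φ(t₁(x)h) d₁h` and `d^×x = dx/|x|_F`. -/
theorem statement9
    (F : Type*) [RCLike F] [MeasurableSpace F] [BorelSpace F]
    (n : ℕ) (hn : 1 ≤ n) (N : ℕ)
    [MeasurableSpace (Matrix (Fin n) (Fin n) F)]
    [BorelSpace (Matrix (Fin n) (Fin n) F)]
    -- `μp` is the Lebesgue (additive Haar) measure `d⁺X` on `M_n(F)`
    (μp : Measure (Matrix (Fin n) (Fin n) F)) [μp.IsAddHaarMeasure]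
    -- `μ₁` is a Haar measure of `SL_n(F)`, viewed as a measure on the matrix space
    (μ₁ : Measure (Matrix (Fin n) (Fin n) F))
    (hμ₁supp : μ₁ {h | h.det ≠ 1} = 0)
    (hμ₁inv : ∀ s : Matrix (Fin n) (Fin n) F, s.det = 1 →
      Measure.map (fun h => s * h) μ₁ = μ₁)
    (hμ₁fin : ∀ K : Set (Matrix (Fin n) (Fin n) F), IsCompact K → μ₁ K < ⊤)
    -- `μF` is an additive Haar measure on `F`, so that `d^×x = dx/|x|_F` is a Haar measure
    -- on `Fˣ`
    (μF : Measure F) [μF.IsAddHaarMeasure] :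
    ∃ s₀ : ℝ,
      ∀ φ : Matrix (Fin n) (Fin n) F → ℂ,
        ContDiffOn ℝ (⊤ : ℕ∞) (fun g : Fin n → Fin n → F => φ (Matrix.of g))
          {g : Fin n → Fin n → F | (Matrix.of g).det ≠ 0} →
        ∀ C : ℝ, 0 < C →
        (∀ g : Matrix (Fin n) (Fin n) F, IsUnit g.det →
          ‖φ g‖ ≤ C * (1 + RCLike.re ((gᴴ * g).trace)
            + RCLike.re (((g⁻¹)ᴴ * g⁻¹).trace)) ^ N) →
      ∀ c : Matrix (Fin n) (Fin n) F → ℂ,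
        ContDiff ℝ (⊤ : ℕ∞) (fun g : Fin n → Fin n → F => c (Matrix.of g)) →
        HasCompactSupport (fun g : Fin n → Fin n → F => c (Matrix.of g)) →
        tsupport (fun g : Fin n → Fin n → F => c (Matrix.of g))
          ⊆ {g : Fin n → Fin n → F | (Matrix.of g).det ≠ 0} →
      ∀ χ : F → ℂ,
        (∀ x y : F, x ≠ 0 → y ≠ 0 → χ (x * y) = χ x * χ y) →
        (∀ x : F, x ≠ 0 → ‖χ x‖ = 1) →
        ContinuousOn χ {x : F | x ≠ 0} →
      ∀ s : ℂ, s.re < s₀ →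
        Integrable
          (fun x : F =>
            (∫ h, convGJArch F n μp c (t1Arch F n x * h) * φ (t1Arch F n x * h) ∂μ₁)
              * (χ x)⁻¹ * ((absNorm F x : ℂ) ^ (-s)))
          (μF.withDensity fun x => ENNReal.ofReal (absNorm F x)⁻¹) := by
  refine ⟨-((n : ℝ) / 2) - 2 * N, fun φ hφ C hC hφC c hc hcs hcd χ _ hχ1 hχc s hs => ?_⟩
  have : IsFiniteMeasureOnCompacts μ₁ := ⟨fun K hK => hμ₁fin K hK⟩
  have : SigmaFinite μ₁ := inferInstance
  have : SigmaFinite μp := inferInstance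
  set D := μF.withDensity fun x => ENNReal.ofReal (absNorm F x)⁻¹ with hD
  obtain ⟨d, hd⟩ : ∃ d : ℕ, d = Module.finrank ℝ F := ⟨_, rfl⟩
  have hd1 : (1 : ℝ) ≤ d := by
    rw [hd]; exact_mod_cast Module.finrank_pos (R := ℝ) (M := F)
  obtain ⟨τ, hτ⟩ : ∃ τ : ℝ, τ = d * ((n : ℝ) / 2) + d * (-s.re) - 2 * N := ⟨_, rfl⟩
  have hτn : (Module.finrank ℝ F * n : ℕ) ≤ τ := by
    rw [← hd, hτ]
    push_cast
    have hN : (0 : ℝ) ≤ N := Nat.cast_nonneg N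
    nlinarith
  obtain ⟨k, hk⟩ := exists_lintegral_t1Arch_lt_top hn μp μ₁ hμ₁supp hμ₁inv hμ₁fin μF hτn
  obtain ⟨A, hA, hgauge⟩ := exists_gauge_le (F := F) n N
  obtain ⟨Ψ, hΨc, hΨdecay, hΨ⟩ := exists_convGJArch_decay μp hc hcs hcd
  obtain ⟨B, hB⟩ := hΨdecay (4 * n * N + 2 * N + k)
  have hae : ∀ᵐ p ∂(D.prod μ₁), p.1 ≠ 0 ∧ p.2.det = 1 :=
    (Measure.quasiMeasurePreserving_fst.ae (ae_ne_zero_field μF)).and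
      (Measure.quasiMeasurePreserving_snd.ae (show ∀ᵐ h ∂μ₁, h.det = 1 from hμ₁supp))
  have hdet : ∀ (x : F) (h : Matrix (Fin n) (Fin n) F),
      (t1Arch F n x * h).det = x * h.det := fun x h => by rw [det_mul, det_t1Arch hn]
  have hint : Integrable (fun p : F × Matrix (Fin n) (Fin n) F =>
      convGJArch F n μp c (t1Arch F n p.1 * p.2) * φ (t1Arch F n p.1 * p.2) *
        (χ p.1)⁻¹ * ((absNorm F p.1 : ℂ) ^ (-s))) (D.prod μ₁) := by
    refine Integrable.mono' ((integrable_det_rpow_mul μ₁ D hk).const_mul (C * A * B)) ?_ ?_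
    · have hcont : ContinuousOn (fun p : F × Matrix (Fin n) (Fin n) F =>
          ((absNorm F (t1Arch F n p.1 * p.2).det ^ ((n : ℝ) / 2) : ℝ) : ℂ) *
            Ψ (t1Arch F n p.1 * p.2) * φ (t1Arch F n p.1 * p.2) *
            (χ p.1)⁻¹ * ((absNorm F p.1 : ℂ) ^ (-s))) {p | p.1 ≠ 0 ∧ p.2.det ≠ 0} := by
        have hw : Continuous fun p : F × Matrix (Fin n) (Fin n) F => t1Arch F n p.1 * p.2 :=
          (continuous_t1Arch.comp continuous_fst).matrix_mul continuous_snd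
        have hφ' : ContinuousOn φ {g | g.det ≠ 0} := hφ.continuousOn
        have h1 : Continuous fun p : F × Matrix (Fin n) (Fin n) F =>
            ((absNorm F (t1Arch F n p.1 * p.2).det ^ ((n : ℝ) / 2) : ℝ) : ℂ) :=
          Complex.continuous_ofReal.comp
            ((continuous_absNorm.comp hw.matrix_det).rpow_const fun _ => Or.inr (by positivity))
        have h2 : ContinuousOn (fun p : F × Matrix (Fin n) (Fin n) F =>
            φ (t1Arch F n p.1 * p.2)) {p | p.1 ≠ 0 ∧ p.2.det ≠ 0} :=
          hφ'.comp hw.continuousOn fun p hp => by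
            rw [Set.mem_ofPred_eq, hdet]; exact mul_ne_zero hp.1 hp.2
        have h3 : ContinuousOn (fun p : F × Matrix (Fin n) (Fin n) F => (χ p.1)⁻¹)
            {p | p.1 ≠ 0 ∧ p.2.det ≠ 0} :=
          (hχc.comp continuous_fst.continuousOn fun p hp => hp.1).inv₀ fun p hp => by
            rw [← norm_ne_zero_iff, Function.comp_apply, hχ1 _ hp.1]; exact one_ne_zero
        have h4 : ContinuousOn (fun p : F × Matrix (Fin n) (Fin n) F =>
            ((absNorm F p.1 : ℂ) ^ (-s))) {p | p.1 ≠ 0 ∧ p.2.det ≠ 0} := by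
          refine ContinuousOn.cpow_const (Complex.continuous_ofReal.comp
            (continuous_absNorm.comp continuous_fst)).continuousOn fun p hp => ?_
          exact Complex.ofReal_mem_slitPlane.2 (absNorm_pos hp.1)
        exact (((h1.mul (hΨc.comp hw)).continuousOn.mul h2).mul h3).mul h4
      refine (aestronglyMeasurable_prod_of_continuousOn ?_ hcont).congr ?_
      · filter_upwards [hae] with p hp
        exact ⟨hp.1, by rw [hp.2]; exact one_ne_zero⟩
      · filter_upwards [hae] with p hp
        rw [hΨ _ (by rw [hdet, hp.2, mul_one]; exact hp.1)]
    · filter_upwards [hae] with p hp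
      obtain ⟨w, hw⟩ : ∃ w, w = t1Arch F n p.1 * p.2 := ⟨_, rfl⟩
      have hwdet : w.det = p.1 := by rw [hw, hdet, hp.2, mul_one]
      have hw0 : w.det ≠ 0 := by rw [hwdet]; exact hp.1
      have hx : 0 < ‖p.1‖ := norm_pos_iff.2 hp.1
      have hφw : ‖φ w‖ ≤ C * (A * (1 + entryNorm w) ^ (4 * n * N + 2 * N) *
          (‖p.1‖ ^ (2 * N))⁻¹) := by
        have := hgauge w hw0
        rw [hwdet] at this
        exact (hφC w (isUnit_iff_ne_zero.2 hw0)).trans (by gcongr)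
      have he := entryNorm_nonneg w
      have hpow : (absNorm F p.1 ^ ((n : ℝ) / 2)) * absNorm F p.1 ^ (-s.re) *
          (‖p.1‖ ^ (2 * N))⁻¹ = ‖p.1‖ ^ τ := by
        rw [absNorm, ← hd, ← Real.rpow_natCast, ← Real.rpow_natCast, ← Real.rpow_mul hx.le,
          ← Real.rpow_mul hx.le, ← Real.rpow_neg hx.le, ← Real.rpow_add hx, ← Real.rpow_add hx, hτ]
        congr 1
        push_cast
        ring
      have hΨw : ‖Ψ w‖ * (1 + entryNorm w) ^ (4 * n * N + 2 * N) ≤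
          B * ((1 + entryNorm w) ^ k)⁻¹ := by
        have h := hB w
        rw [pow_add, ← mul_assoc] at h
        exact (le_mul_inv_iff₀ (by positivity)).2 h
      rw [← hw, hΨ w hw0, norm_mul, norm_mul, norm_mul, norm_mul, norm_inv, hχ1 _ hp.1,
        Complex.norm_real, Complex.norm_cpow_eq_rpow_re_of_pos (absNorm_pos hp.1), hwdet,
        Real.norm_of_nonneg (Real.rpow_nonneg (absNorm_nonneg _) _), inv_one, mul_one,
        Complex.neg_re]
      have ha := absNorm_nonneg p.1
      calc absNorm F p.1 ^ ((n : ℝ) / 2) * ‖Ψ w‖ * ‖φ w‖ * absNorm F p.1 ^ (-s.re)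
          ≤ absNorm F p.1 ^ ((n : ℝ) / 2) * ‖Ψ w‖ * (C * (A * (1 + entryNorm w) ^
            (4 * n * N + 2 * N) * (‖p.1‖ ^ (2 * N))⁻¹)) * absNorm F p.1 ^ (-s.re) := by
            gcongr
        _ = C * A * (‖Ψ w‖ * (1 + entryNorm w) ^ (4 * n * N + 2 * N)) *
            ((absNorm F p.1 ^ ((n : ℝ) / 2)) * absNorm F p.1 ^ (-s.re) *
              (‖p.1‖ ^ (2 * N))⁻¹) := by ring
        _ ≤ C * A * (B * ((1 + entryNorm w) ^ k)⁻¹) * ‖p.1‖ ^ τ := by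
            rw [hpow]; gcongr
        _ = _ := by ring
  have := hint.integral_prod_left
  simpa only [integral_mul_const] using this
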